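/- Let K ∈ ℂ^{n×n} with n = n₁+⋯+n_d. Let L be a nonzero positive semidefinite element of 𝒲_K^⊥, factored as L = XX* with X ∈ ℂ^{n×m} where m = rank(L), write X = col(X₁,…,X_d) and K*X = col(Y₁,…,Y_d) with X_j, Y_j ∈ ℂ^{n_j×m}. Then L generates an extreme ray of the cone 𝒲_K^⊥ ∩ PSD if and only if every Hermitian H ∈ ℂ^{m×m} with 0 ≤ H ≤ I_m and X_j H X_j* = Y_j H Y_j* for j = 1,…,d is a real scalar multiple of I_m. -/

import Mathlib

open Matrix Kronecker
open scoped ComplexOrder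

/-- The index type for the block decomposition `n = n₁ + ⋯ + n_d`:
`BIdx nn ≃ Fin (n₁ + ⋯ + n_d)`. -/
abbrev BIdx {d : ℕ} (nn : Fin d → ℕ) : Type := (j : Fin d) × Fin (nn j)

/-- The real subspace `𝒲_K = {⊕_j H_j − K (⊕_j H_j) K* : H_j Hermitian}` of `ℋ_n`. -/
def WK {d : ℕ} (nn : Fin d → ℕ) (K : Matrix (BIdx nn) (BIdx nn) ℂ) :
    Set (Matrix (BIdx nn) (BIdx nn) ℂ) :=
  { W | ∃ H : ∀ j : Fin d, Matrix (Fin (nn j)) (Fin (nn j)) ℂ,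
      (∀ j, (H j).IsHermitian) ∧
      W = Matrix.blockDiagonal' H - K * Matrix.blockDiagonal' H * Kᴴ }

/-- The orthogonal complement `𝒲_K^⊥` of `𝒲_K` inside the Hermitian matrices `ℋ_n`,
with respect to the trace inner product `⟨A,B⟩ = Tr(AB)`. -/
def WKperp {d : ℕ} (nn : Fin d → ℕ) (K : Matrix (BIdx nn) (BIdx nn) ℂ) :
    Set (Matrix (BIdx nn) (BIdx nn) ℂ) :=
  { L | L.IsHermitian ∧ ∀ W ∈ WK nn K, Matrix.trace (L * W) = 0 }

/-- The `j`-th block `X_j ∈ ℂ^{n_j × m}` of `X = col(X₁,…,X_d) ∈ ℂ^{n × m}`. -/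
def blk {d : ℕ} (nn : Fin d → ℕ) {m : ℕ} (X : Matrix (BIdx nn) (Fin m) ℂ)
    (j : Fin d) : Matrix (Fin (nn j)) (Fin m) ℂ :=
  fun a k => X ⟨j, a⟩ k

/-- A nonzero `L ∈ C` generates an extreme ray of the convex cone `C` if whenever
`L = L₁ + L₂` with `L₁, L₂ ∈ C`, both `L₁` and `L₂` are real scalar multiples of `L`. -/
def GeneratesExtremeRay {ι : Type*} (C : Set (Matrix ι ι ℂ)) (L : Matrix ι ι ℂ) : Prop :=
  L ∈ C ∧ L ≠ 0 ∧ ∀ L₁ ∈ C, ∀ L₂ ∈ C, L = L₁ + L₂ →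
    (∃ t : ℝ, L₁ = t • L) ∧ (∃ t : ℝ, L₂ = t • L)

/-- The trace pairing of a matrix with a block diagonal matrix only sees the diagonal blocks. -/
theorem trace_mul_blockDiagonal' {d : ℕ} (nn : Fin d → ℕ) (M : Matrix (BIdx nn) (BIdx nn) ℂ)
    (H : ∀ j : Fin d, Matrix (Fin (nn j)) (Fin (nn j)) ℂ) :
    trace (M * blockDiagonal' H) = ∑ j, trace (blockDiag' M j * H j) := by
  simp only [trace, diag_apply, mul_apply, Fintype.sum_sigma]
  refine Finset.sum_congr rfl fun j _ => Finset.sum_congr rfl fun a _ => ?_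
  rw [Finset.sum_eq_single j]
  · simp [blockDiagonal'_apply_eq, blockDiag'_apply]
  · intro i _ hij
    exact Finset.sum_eq_zero fun b _ => by rw [blockDiagonal'_apply_ne _ _ _ hij, mul_zero]
  · simp

/-- A Hermitian matrix `A` lies in `𝒲_K^⊥` iff `A` and `K* A K` have the same diagonal blocks. -/
theorem mem_WKperp_iff {d : ℕ} (nn : Fin d → ℕ) (K A : Matrix (BIdx nn) (BIdx nn) ℂ)
    (hA : A.IsHermitian) :
    A ∈ WKperp nn K ↔ ∀ j, blockDiag' A j = blockDiag' (Kᴴ * A * K) j := by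
  have pairing : ∀ H : ∀ j : Fin d, Matrix (Fin (nn j)) (Fin (nn j)) ℂ,
      trace (A * (blockDiagonal' H - K * blockDiagonal' H * Kᴴ)) =
        ∑ j, trace (blockDiag' (A - Kᴴ * A * K) j * H j) := by
    intro H
    rw [← trace_mul_blockDiagonal', Matrix.mul_sub, Matrix.sub_mul, trace_sub, trace_sub]
    congr 1
    rw [← Matrix.mul_assoc, trace_mul_comm]
    simp only [Matrix.mul_assoc]
  have hM : (A - Kᴴ * A * K).IsHermitian := hA.sub (isHermitian_conjTranspose_mul_mul K hA)
  have hMj : ∀ j, (blockDiag' (A - Kᴴ * A * K) j)ᴴ = blockDiag' (A - Kᴴ * A * K) j := fun j => by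
    rw [← blockDiag'_conjTranspose, hM.eq]
  constructor
  · rintro ⟨-, h⟩ j
    have h0 := h _ ⟨blockDiag' (A - Kᴴ * A * K), hMj, rfl⟩
    rw [pairing, Finset.sum_eq_zero_iff_of_nonneg] at h0
    · have := h0 j (Finset.mem_univ j)
      nth_rewrite 1 [← hMj j] at this
      rw [trace_conjTranspose_mul_self_eq_zero_iff] at this
      rwa [blockDiag'_sub, Pi.sub_apply, sub_eq_zero] at this
    · intro i _
      nth_rewrite 1 [← hMj i]
      exact (posSemidef_conjTranspose_mul_self _).trace_nonneg
  · intro h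
    refine ⟨hA, ?_⟩
    rintro _ ⟨H, -, rfl⟩
    rw [pairing]
    refine Finset.sum_eq_zero fun j _ => ?_
    rw [blockDiag'_sub, Pi.sub_apply, h j, sub_self, Matrix.zero_mul, trace_zero]

/-- The diagonal blocks of `X H X*` are the `X_j H X_j*`. -/
theorem blockDiag'_mul_mul_conjTranspose {d : ℕ} (nn : Fin d → ℕ) {m : ℕ}
    (X : Matrix (BIdx nn) (Fin m) ℂ) (H : Matrix (Fin m) (Fin m) ℂ) (j : Fin d) :
    blockDiag' (X * H * Xᴴ) j = blk nn X j * H * (blk nn X j)ᴴ := by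
  ext a b
  simp [blockDiag'_apply, mul_apply, blk]

/-- Membership of `X H X*` in `𝒲_K^⊥` in terms of the blocks of `X` and `K* X`. -/
theorem mul_mul_conjTranspose_mem_WKperp_iff {d : ℕ} (nn : Fin d → ℕ) {m : ℕ}
    (K : Matrix (BIdx nn) (BIdx nn) ℂ) (X : Matrix (BIdx nn) (Fin m) ℂ)
    {H : Matrix (Fin m) (Fin m) ℂ} (hH : H.IsHermitian) :
    X * H * Xᴴ ∈ WKperp nn K ↔ ∀ j, blk nn X j * H * (blk nn X j)ᴴ =
      blk nn (Kᴴ * X) j * H * (blk nn (Kᴴ * X) j)ᴴ := by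
  rw [mem_WKperp_iff nn K _ (isHermitian_mul_mul_conjTranspose X hH)]
  have e : Kᴴ * (X * H * Xᴴ) * K = (Kᴴ * X) * H * (Kᴴ * X)ᴴ := by
    simp [Matrix.mul_assoc]
  simp only [e, blockDiag'_mul_mul_conjTranspose]

theorem sub_mem_WKperp {d : ℕ} (nn : Fin d → ℕ) {K A B : Matrix (BIdx nn) (BIdx nn) ℂ}
    (hA : A ∈ WKperp nn K) (hB : B ∈ WKperp nn K) : A - B ∈ WKperp nn K :=
  ⟨hA.1.sub hB.1, fun W hW => by rw [Matrix.sub_mul, trace_sub, hA.2 W hW, hB.2 W hW, sub_zero]⟩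

/-- If `X X*` has rank equal to the number of columns of `X`, then `X` has a left inverse. -/
theorem exists_left_inverse_of_rank {ι : Type*} [Fintype ι] {m : ℕ}
    (X : Matrix ι (Fin m) ℂ) (h : (X * Xᴴ).rank = m) :
    ∃ Z : Matrix (Fin m) ι ℂ, Z * X = 1 := by
  have hr : (Xᴴ * X).rank = Fintype.card (Fin m) := by
    rw [rank_conjTranspose_mul_self, ← rank_self_mul_conjTranspose, h, Fintype.card_fin]
  have hu : IsUnit (Xᴴ * X) := by
    rw [← mulVec_surjective_iff_isUnit]
    have : LinearMap.range (Xᴴ * X).mulVecLin = ⊤ := by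
      apply Submodule.eq_top_of_finrank_eq
      rw [← Matrix.rank, hr, Module.finrank_fintype_fun_eq_card]
    exact LinearMap.range_eq_top.1 this
  refine ⟨(Xᴴ * X)⁻¹ * Xᴴ, ?_⟩
  rw [Matrix.mul_assoc, nonsing_inv_mul _ ((isUnit_iff_isUnit_det _).1 hu)]

open scoped MatrixOrder Matrix.Norms.L2Operator in
/-- A matrix annihilating a sum of positive semidefinite matrices annihilates each summand. -/
theorem mul_eq_zero_of_mul_add_eq_zero {ι κ : Type*} [Fintype ι] [Fintype κ]
    {A B : Matrix ι ι ℂ} (hA : A.PosSemidef) (hB : B.PosSemidef) (Q : Matrix κ ι ℂ)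
    (h : Q * (A + B) = 0) : Q * A = 0 := by
  classical
  have hs : Q * A * Qᴴ + Q * B * Qᴴ = 0 := by
    rw [← Matrix.add_mul, ← Matrix.mul_add, h, Matrix.zero_mul]
  have hA' := hA.mul_mul_conjTranspose_same Q
  have hB' := hB.mul_mul_conjTranspose_same Q
  have ht : trace (Q * A * Qᴴ) + trace (Q * B * Qᴴ) = 0 := by
    rw [← trace_add, hs, trace_zero]
  have h0 : Q * A * Qᴴ = 0 :=
    hA'.trace_eq_zero_iff.1 ((add_eq_zero_iff_of_nonneg hA'.trace_nonneg hB'.trace_nonneg).1 ht).1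
  obtain ⟨C, rfl⟩ : ∃ C, A = Cᴴ * C := CStarAlgebra.nonneg_iff_eq_star_mul_self.1 hA.nonneg
  have hQ : Q * Cᴴ * (Q * Cᴴ)ᴴ = 0 := by
    simpa [Matrix.mul_assoc] using h0
  rw [← Matrix.mul_assoc, self_mul_conjTranspose_eq_zero.1 hQ, Matrix.zero_mul]

theorem stmt14 {d : ℕ} (nn : Fin d → ℕ) (hnn : ∀ j, 0 < nn j)
    (K : Matrix (BIdx nn) (BIdx nn) ℂ)
    (L : Matrix (BIdx nn) (BIdx nn) ℂ) (hL0 : L ≠ 0) (hpsd : L.PosSemidef)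
    (hLperp : L ∈ WKperp nn K) {m : ℕ} (hm : L.rank = m)
    (X : Matrix (BIdx nn) (Fin m) ℂ) (hLX : L = X * Xᴴ) :
    GeneratesExtremeRay {A | A ∈ WKperp nn K ∧ A.PosSemidef} L ↔
      ∀ H : Matrix (Fin m) (Fin m) ℂ, H.IsHermitian → H.PosSemidef →
        ((1 : Matrix (Fin m) (Fin m) ℂ) - H).PosSemidef →
        (∀ j, blk nn X j * H * (blk nn X j)ᴴ =
          blk nn (Kᴴ * X) j * H * (blk nn (Kᴴ * X) j)ᴴ) →
        ∃ t : ℝ, H = t • (1 : Matrix (Fin m) (Fin m) ℂ) := by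
  obtain ⟨Z, hZ⟩ := exists_left_inverse_of_rank X (hLX ▸ hm)
  have hZ' : Xᴴ * Zᴴ = 1 := by rw [← conjTranspose_mul, hZ, conjTranspose_one]
  have cancel : ∀ H : Matrix (Fin m) (Fin m) ℂ, Z * (X * H * Xᴴ) * Zᴴ = H := fun H => by
    rw [Matrix.mul_assoc, Matrix.mul_assoc (X * H), hZ', Matrix.mul_one, ← Matrix.mul_assoc, hZ,
      Matrix.one_mul]
  have hZL : Z * L * Zᴴ = 1 := by simpa [← hLX] using cancel 1
  constructor
  · rintro ⟨-, -, hext⟩ H hH hpos hle hblk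
    have hL₁ : X * H * Xᴴ ∈ WKperp nn K := (mul_mul_conjTranspose_mem_WKperp_iff nn K X hH).2 hblk
    have hL₂ : L - X * H * Xᴴ = X * (1 - H) * Xᴴ := by
      rw [hLX, Matrix.mul_sub, Matrix.mul_one, Matrix.sub_mul]
    obtain ⟨⟨t, ht⟩, -⟩ := hext (X * H * Xᴴ) ⟨hL₁, hpos.mul_mul_conjTranspose_same X⟩
      (L - X * H * Xᴴ)
      ⟨sub_mem_WKperp nn hLperp hL₁, hL₂ ▸ hle.mul_mul_conjTranspose_same X⟩
      (add_sub_cancel _ _).symm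
    refine ⟨t, ?_⟩
    rw [← cancel H, ht, Matrix.mul_smul, Matrix.smul_mul, hZL]
  · intro h
    refine ⟨⟨hLperp, hpsd⟩, hL0, ?_⟩
    rintro L₁ ⟨h₁, hp₁⟩ L₂ ⟨-, hp₂⟩ hsum
    have hQ : (1 - X * Z) * (L₁ + L₂) = 0 := by
      rw [← hsum, hLX, ← Matrix.mul_assoc, Matrix.sub_mul, Matrix.mul_assoc X, hZ, Matrix.one_mul,
        Matrix.mul_one, sub_self, Matrix.zero_mul]
    have hXZ : X * Z * L₁ = L₁ := by
      have := mul_eq_zero_of_mul_add_eq_zero hp₁ hp₂ _ hQ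
      rw [Matrix.sub_mul, Matrix.one_mul, sub_eq_zero] at this
      exact this.symm
    have hXZ' : L₁ * (Zᴴ * Xᴴ) = L₁ := by
      have := congrArg conjTranspose hXZ
      rwa [conjTranspose_mul, conjTranspose_mul, hp₁.1.eq] at this
    have hL₁ : X * (Z * L₁ * Zᴴ) * Xᴴ = L₁ := by
      calc X * (Z * L₁ * Zᴴ) * Xᴴ = X * Z * L₁ * (Zᴴ * Xᴴ) := by simp only [Matrix.mul_assoc]
        _ = L₁ := by rw [hXZ, hXZ']
    have hH := hp₁.mul_mul_conjTranspose_same Z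
    have hcompl : 1 - Z * L₁ * Zᴴ = Z * L₂ * Zᴴ := by
      rw [← hZL, hsum, Matrix.mul_add, Matrix.add_mul, add_sub_cancel_left]
    obtain ⟨t, ht⟩ := h (Z * L₁ * Zᴴ) hH.1 hH (hcompl ▸ hp₂.mul_mul_conjTranspose_same Z)
      ((mul_mul_conjTranspose_mem_WKperp_iff nn K X hH.1).1 (hL₁.symm ▸ h₁))
    have ht₁ : L₁ = t • L := by
      rw [← hL₁, ht, Matrix.mul_smul, Matrix.smul_mul, Matrix.mul_one, ← hLX]
    refine ⟨⟨t, ht₁⟩, 1 - t, ?_⟩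
    rw [sub_smul, one_smul, ← ht₁, hsum, add_sub_cancel_left]
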